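/- Consider the linear control system ẋ = Ax + Bu on ℝⁿ and n-dimensional polytopes X, X' such that 0 ∈ X° ⊂ X'°. If the system is relaxed in-block controllable (RIBC) with respect to X through X', then there exists an n-dimensional compact convex set X₁ with X ⊆ X₁ ⊆ X' such that the invariance conditions of X₁ are solvable: for each x ∈ ∂X₁ there exists u ∈ ℝ^m with Ax + Bu ∈ T_{X₁}(x), the Bouligand tangent cone to X₁ at x. -/

import Mathlib

open Matrix Set Pointwise MeasureTheory

/-- Carathéodory (integral) solution of `ẋ = A x + B u + a` on `[0, T]`. -/
def IsSol {n m : ℕ} (A : Matrix (Fin n) (Fin n) ℝ) (B : Matrix (Fin n) (Fin m) ℝ)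
    (a : Fin n → ℝ) (u : ℝ → Fin m → ℝ) (φ : ℝ → Fin n → ℝ) (T : ℝ) : Prop :=
  ∀ t ∈ Set.Icc (0 : ℝ) T,
    φ t = φ 0 + ∫ s in (0 : ℝ)..t, (A.mulVec (φ s) + B.mulVec (u s) + a)

/-- Controllability matrix `[B AB ⋯ A^{n-1}B]`. -/
def ctrbMat {n m : ℕ} (A : Matrix (Fin n) (Fin n) ℝ) (B : Matrix (Fin n) (Fin m) ℝ) :
    Matrix (Fin n) (Fin n × Fin m) ℝ :=
  Matrix.of fun i p => ((A ^ (p.1 : ℕ)) * B) i p.2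

/-- Kalman controllability of the pair `(A, B)`: the controllability matrix has rank `n`. -/
def Controllable {n m : ℕ} (A : Matrix (Fin n) (Fin n) ℝ)
    (B : Matrix (Fin n) (Fin m) ℝ) : Prop :=
  (ctrbMat A B).rank = n

/-- An `n`-dimensional polytope: convex hull of finitely many points, with nonempty interior. -/
def IsNPolytope {n : ℕ} (X : Set (Fin n → ℝ)) : Prop :=
  (∃ V : Finset (Fin n → ℝ), X = convexHull ℝ (V : Set (Fin n → ℝ))) ∧ (interior X).Nonempty

/-- The set `𝒪` of possible equilibria of `ẋ = A x + B u + a`: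
points `x` with `A x + a ∈ Im B`. -/
def equilSet {n m : ℕ} (A : Matrix (Fin n) (Fin n) ℝ) (B : Matrix (Fin n) (Fin m) ℝ)
    (a : Fin n → ℝ) : Set (Fin n → ℝ) :=
  {x | ∃ u : Fin m → ℝ, A.mulVec x + a = B.mulVec u}

/-- The Bouligand tangent cone to a set `S` at `x`. -/
def bouligand {n : ℕ} (S : Set (Fin n → ℝ)) (x : Fin n → ℝ) : Set (Fin n → ℝ) :=
  {v | Filter.liminf (fun t : ℝ => Metric.infDist (x + t • v) S / t)
        (nhdsWithin 0 (Set.Ioi 0)) = 0}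

/-- Relaxed in-block controllability of `ẋ = Ax + Bu + a` w.r.t. `X` through `X'`:
all states of `X°` are mutually accessible through `X'°` with uniformly bounded controls. -/
def RIBC {n m : ℕ} (A : Matrix (Fin n) (Fin n) ℝ) (B : Matrix (Fin n) (Fin m) ℝ)
    (a : Fin n → ℝ) (X X' : Set (Fin n → ℝ)) : Prop :=
  ∃ M > (0 : ℝ), ∀ x ∈ interior X, ∀ y ∈ interior X,
    ∃ T ≥ (0 : ℝ), ∃ u : ℝ → Fin m → ℝ, ∃ φ : ℝ → Fin n → ℝ,
      Measurable u ∧ IsSol A B a u φ T ∧ φ 0 = x ∧ φ T = y ∧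
      (∀ t ∈ Set.Icc (0 : ℝ) T, ‖u t‖ ≤ M) ∧
      (∀ t ∈ Set.Icc (0 : ℝ) T, φ t ∈ interior X')

open Filter Topology

section aux

variable {n m : ℕ}


/-- Averaged step relation. -/
def QStep (A : Matrix (Fin n) (Fin n) ℝ) (B : Matrix (Fin n) (Fin m) ℝ) (M L : ℝ)
    (z w : Fin n → ℝ) (h : ℝ) : Prop :=
  ∃ (ξ : Fin n → ℝ) (u : Fin m → ℝ), ‖u‖ ≤ M ∧ ‖ξ - z‖ ≤ L * h ∧ ‖w - z‖ ≤ L * h ∧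
    w - z = h • (A.mulVec ξ + B.mulVec u)

lemma QStep.trans {A : Matrix (Fin n) (Fin n) ℝ} {B : Matrix (Fin n) (Fin m) ℝ} {M L : ℝ}
    {z w v : Fin n → ℝ} {h k : ℝ} (hh : 0 ≤ h) (hk : 0 ≤ k)
    (h1 : QStep A B M L z w h) (h2 : QStep A B M L w v k) : QStep A B M L z v (h + k) := by
  rcases hk.eq_or_lt with rfl | hk0
  · obtain ⟨ξ, u, a1, a2, a3, a4⟩ := h2
    have : v = w := by simpa [sub_eq_zero] using a4
    simpa [this] using h1
  obtain ⟨ξ, u, a1, a2, a3, a4⟩ := h1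
  obtain ⟨η, y, b1, b2, b3, b4⟩ := h2
  have hp : 0 < h + k := by linarith
  have hc : h / (h + k) + k / (h + k) = 1 := by field_simp
  have c1 : 0 ≤ h / (h + k) := by positivity
  have c2 : 0 ≤ k / (h + k) := by positivity
  refine ⟨(h / (h + k)) • ξ + (k / (h + k)) • η, (h / (h + k)) • u + (k / (h + k)) • y,
    ?_, ?_, ?_, ?_⟩
  · calc _ ≤ ‖(h / (h + k)) • u‖ + ‖(k / (h + k)) • y‖ := norm_add_le _ _
      _ = (h / (h + k)) * ‖u‖ + (k / (h + k)) * ‖y‖ := by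
        rw [norm_smul, norm_smul, Real.norm_of_nonneg c1, Real.norm_of_nonneg c2]
      _ ≤ (h / (h + k)) * M + (k / (h + k)) * M := by gcongr
      _ = M := by rw [← add_mul, hc, one_mul]
  · have e : (h / (h + k)) • ξ + (k / (h + k)) • η - z
        = (h / (h + k)) • (ξ - z) + (k / (h + k)) • ((η - w) + (w - z)) := by
      have : z = (h / (h + k) + k / (h + k)) • z := by rw [hc, one_smul]
      nth_rewrite 1 [this]
      module
    have hb : ‖ξ - z‖ ≤ L * (h + k) := by
      have := (norm_nonneg _).trans b2
      linarith [mul_add L h k]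
    have hb' : ‖(η - w) + (w - z)‖ ≤ L * (h + k) := by
      have := norm_add_le (η - w) (w - z)
      linarith [mul_add L h k]
    rw [e]
    calc _ ≤ ‖(h / (h + k)) • (ξ - z)‖ + ‖(k / (h + k)) • ((η - w) + (w - z))‖ := norm_add_le _ _
      _ = (h / (h + k)) * ‖ξ - z‖ + (k / (h + k)) * ‖(η - w) + (w - z)‖ := by
        rw [norm_smul, norm_smul, Real.norm_of_nonneg c1, Real.norm_of_nonneg c2]
      _ ≤ (h / (h + k)) * (L * (h + k)) + (k / (h + k)) * (L * (h + k)) := by gcongr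
      _ = L * (h + k) := by rw [← add_mul, hc, one_mul]
  · have := norm_add_le (v - w) (w - z)
    rw [sub_add_sub_cancel] at this
    linarith [mul_add L h k]
  · have e1 : (h + k) * (h / (h + k)) = h := by field_simp
    have e2 : (h + k) * (k / (h + k)) = k := by field_simp
    have : v - z = (w - z) + (v - w) := by abel
    rw [this, a4, b4]
    simp only [Matrix.mulVec_add, Matrix.mulVec_smul, smul_add, smul_smul, e1, e2]
    abel

/-- From `z` one can step to `R` for every duration up to `h`. -/
def SReach (A : Matrix (Fin n) (Fin n) ℝ) (B : Matrix (Fin n) (Fin m) ℝ) (M L : ℝ)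
    (R : Set (Fin n → ℝ)) (z : Fin n → ℝ) (h : ℝ) : Prop :=
  ∀ k ∈ Set.Icc 0 h, ∃ w ∈ R, QStep A B M L z w k

lemma SReach.trans {A : Matrix (Fin n) (Fin n) ℝ} {B : Matrix (Fin n) (Fin m) ℝ} {M L : ℝ}
    {R : Set (Fin n → ℝ)} {z w : Fin n → ℝ} {h k : ℝ} (hh : 0 ≤ h)
    (h1 : SReach A B M L R z h) (hq : QStep A B M L z w h) (h2 : SReach A B M L R w k) :
    SReach A B M L R z (h + k) := by
  intro t ht
  rcases le_total t h with h3 | h3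
  · exact h1 t ⟨ht.1, h3⟩
  · obtain ⟨v, hv, hq'⟩ := h2 (t - h) ⟨by linarith, by linarith [ht.2]⟩
    refine ⟨v, hv, ?_⟩
    have := hq.trans hh (by linarith) hq'
    simpa using this

/-- Trajectories yield integrable data. -/
lemma IsSol.integrable {A : Matrix (Fin n) (Fin n) ℝ} {B : Matrix (Fin n) (Fin m) ℝ}
    {u : ℝ → Fin m → ℝ} {φ : ℝ → Fin n → ℝ} {T M K : ℝ} (hT : 0 ≤ T)
    (hu : Measurable u) (hs : IsSol A B 0 u φ T)
    (hM : ∀ t ∈ Set.Icc (0 : ℝ) T, ‖u t‖ ≤ M) (hK : ∀ t ∈ Set.Icc (0 : ℝ) T, ‖φ t‖ ≤ K) :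
    IntegrableOn φ (Set.Icc 0 T) ∧ IntegrableOn u (Set.Icc 0 T) := by
  have hfin : volume (Set.Icc 0 T) < ⊤ := by simp
  refine ⟨?_, ?_⟩
  swap
  · refine Measure.integrableOn_of_bounded (M := M) hfin.ne hu.aestronglyMeasurable ?_
    filter_upwards [ae_restrict_mem measurableSet_Icc] with t ht using hM t ht
  set f : ℝ → Fin n → ℝ := fun s => A.mulVec (φ s) + B.mulVec (u s) + 0 with hf
  set S : Set ℝ := {t | t ∈ Set.Icc 0 T ∧ IntervalIntegrable f volume 0 t} with hS
  have hSo : S.OrdConnected := by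
    refine ⟨fun x hx y hy z hz => ⟨⟨hx.1.1.trans hz.1, hz.2.trans hy.1.2⟩, ?_⟩⟩
    refine hy.2.mono_set ?_
    rw [uIcc_of_le hy.1.1, uIcc_of_le (hx.1.1.trans hz.1)]
    exact Icc_subset_Icc_right hz.2
  have hSm : MeasurableSet S := hSo.measurableSet
  have hcont : ContinuousOn φ S := by
    intro t ht
    have key : ∀ y ∈ S, ContinuousOn φ (Set.Icc 0 y) := by
      intro y hy
      have h1 : ContinuousOn (fun x => ∫ s in (0:ℝ)..x, f s) (Set.uIcc 0 y) := 
        intervalIntegral.continuousOn_primitive_interval' hy.2 left_mem_uIcc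
      rw [uIcc_of_le hy.1.1] at h1
      refine (continuousOn_const (c := φ 0)).add h1 |>.congr ?_
      intro s hs'
      exact hs s ⟨hs'.1, hs'.2.trans hy.1.2⟩
    by_cases hex : ∃ y ∈ S, t < y
    · obtain ⟨y, hy, hty⟩ := hex
      have := key y hy t ⟨ht.1.1, hty.le⟩
      refine this.mono_of_mem_nhdsWithin ?_
      have h2 : Set.Iio y ∈ 𝓝 t := Iio_mem_nhds hty
      filter_upwards [mem_nhdsWithin_of_mem_nhds h2, self_mem_nhdsWithin] with s h3 h4
      exact ⟨h4.1.1, le_of_lt h3⟩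
    · push Not at hex
      exact (key t ht t ⟨ht.1.1, le_rfl⟩).mono fun s hs' => ⟨hs'.1.1, hex s hs'⟩
  have hm1 : AEStronglyMeasurable φ (volume.restrict S) :=
    hcont.aestronglyMeasurable hSm
  have hm2 : AEStronglyMeasurable φ (volume.restrict (Set.Icc 0 T \ S)) := by
    refine (aestronglyMeasurable_const (b := φ 0)).congr ?_
    filter_upwards [ae_restrict_mem (measurableSet_Icc.diff hSm)] with t ht
    have h1 : ¬ IntervalIntegrable f volume 0 t := fun h => ht.2 ⟨ht.1, h⟩
    have h2 := hs t ht.1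
    rw [intervalIntegral.integral_undef h1, add_zero] at h2
    exact h2.symm
  have hun : S ∪ (Set.Icc 0 T \ S) = Set.Icc 0 T := by
    apply Set.union_diff_cancel
    exact fun x hx => hx.1
  have hm : AEStronglyMeasurable φ (volume.restrict (Set.Icc 0 T)) := by
    rw [← hun]
    exact aestronglyMeasurable_union_iff.2 ⟨hm1, hm2⟩
  refine ⟨hm, HasFiniteIntegral.restrict_of_bounded (C := K) hfin ?_⟩
  filter_upwards [ae_restrict_mem measurableSet_Icc] with t ht using hK t ht

lemma norm_mulVec_bound (p q : ℕ) (A : Matrix (Fin p) (Fin q) ℝ) :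
    ∃ C : ℝ, 0 ≤ C ∧ ∀ x, ‖A.mulVec x‖ ≤ C * ‖x‖ := by
  refine ⟨‖(Matrix.mulVecLin A).toContinuousLinearMap‖, norm_nonneg _, fun x => ?_⟩
  exact (Matrix.mulVecLin A).toContinuousLinearMap.le_opNorm x

lemma IsSol.qstep {A : Matrix (Fin n) (Fin n) ℝ} {B : Matrix (Fin n) (Fin m) ℝ}
    {u : ℝ → Fin m → ℝ} {φ : ℝ → Fin n → ℝ} {T M K L : ℝ} (hT : 0 ≤ T)
    (hu : Measurable u) (hs : IsSol A B 0 u φ T)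
    (hM : ∀ t ∈ Set.Icc (0 : ℝ) T, ‖u t‖ ≤ M) (hK : ∀ t ∈ Set.Icc (0 : ℝ) T, ‖φ t‖ ≤ K)
    (hL0 : 0 ≤ L)
    (hL : ∀ x y, ‖x‖ ≤ K → ‖y‖ ≤ M → ‖A.mulVec x + B.mulVec y‖ ≤ L)
    {s t : ℝ} (h0s : 0 ≤ s) (hst : s ≤ t) (htT : t ≤ T) :
    QStep A B M L (φ s) (φ t) (t - s) := by
  obtain ⟨iφ, iu⟩ := hs.integrable hT hu hM hK
  rcases hst.eq_or_lt with rfl | hlt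
  · exact ⟨φ s, u s, hM s ⟨h0s, htT⟩, by simp, by simp, by simp⟩
  have jφ : ∀ a b, 0 ≤ a → a ≤ b → b ≤ T → IntervalIntegrable φ volume a b := by
    intro a b ha hab hb
    refine (IntegrableOn.mono_set iφ ?_).intervalIntegrable
    rw [uIcc_of_le hab]; exact Icc_subset_Icc ha hb
  have ju : ∀ a b, 0 ≤ a → a ≤ b → b ≤ T → IntervalIntegrable u volume a b := by
    intro a b ha hab hb
    refine (IntegrableOn.mono_set iu ?_).intervalIntegrable
    rw [uIcc_of_le hab]; exact Icc_subset_Icc ha hb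
  let a := (Matrix.mulVecLin A).toContinuousLinearMap
  let b := (Matrix.mulVecLin B).toContinuousLinearMap
  have jaφ : ∀ p q, 0 ≤ p → p ≤ q → q ≤ T →
      IntervalIntegrable (fun r => A.mulVec (φ r)) volume p q := fun p q h1 h2 h3 => by
    have := jφ p q h1 h2 h3
    exact ⟨a.integrable_comp this.1, a.integrable_comp this.2⟩
  have jbu : ∀ p q, 0 ≤ p → p ≤ q → q ≤ T →
      IntervalIntegrable (fun r => B.mulVec (u r)) volume p q := fun p q h1 h2 h3 => by
    have := ju p q h1 h2 h3
    exact ⟨b.integrable_comp this.1, b.integrable_comp this.2⟩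
  have diff : ∀ p q, 0 ≤ p → p ≤ q → q ≤ T →
      φ q - φ p = ∫ r in p..q, (A.mulVec (φ r) + B.mulVec (u r)) := by
    intro p q h1 h2 h3
    have e1 := hs q ⟨h1.trans h2, h3⟩
    have e2 := hs p ⟨h1, h2.trans h3⟩
    simp only [add_zero] at e1 e2
    have e3 := intervalIntegral.integral_add_adjacent_intervals
      ((jaφ 0 p le_rfl h1 (h2.trans h3)).add (jbu 0 p le_rfl h1 (h2.trans h3)))
      ((jaφ p q h1 h2 h3).add (jbu p q h1 h2 h3))
    rw [e1, e2, ← e3]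
    abel
  have lip : ∀ p q, 0 ≤ p → p ≤ q → q ≤ T → ‖φ q - φ p‖ ≤ L * (q - p) := by
    intro p q h1 h2 h3
    rw [diff p q h1 h2 h3]
    have := intervalIntegral.norm_integral_le_of_norm_le_const (a := p) (b := q) (C := L)
      (f := fun r => A.mulVec (φ r) + B.mulVec (u r)) (by
        intro x hx
        rw [uIoc_of_le h2] at hx
        have hx' : x ∈ Set.Icc 0 T := ⟨h1.trans hx.1.le, hx.2.trans h3⟩
        exact hL _ _ (hK x hx') (hM x hx'))
    rwa [abs_of_nonneg (by linarith)] at this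
  have hd : 0 < t - s := by linarith
  refine ⟨(t - s)⁻¹ • ∫ r in s..t, φ r, (t - s)⁻¹ • ∫ r in s..t, u r, ?_, ?_,
    lip s t h0s hst htT, ?_⟩
  · have := intervalIntegral.norm_integral_le_of_norm_le_const (a := s) (b := t) (C := M)
      (f := u) (by
        intro x hx
        rw [uIoc_of_le hst] at hx
        exact hM x ⟨h0s.trans hx.1.le, hx.2.trans htT⟩)
    rw [abs_of_nonneg hd.le] at this
    rw [norm_smul, Real.norm_of_nonneg (by positivity), inv_mul_le_iff₀ hd]
    linarith [mul_comm M (t - s)]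
  · have e : (t - s)⁻¹ • (∫ r in s..t, φ r) - φ s = (t - s)⁻¹ • ∫ r in s..t, (φ r - φ s) := by
      rw [intervalIntegral.integral_sub (jφ s t h0s hst htT) (by simp),
        intervalIntegral.integral_const, smul_sub, smul_smul, inv_mul_cancel₀ hd.ne', one_smul]
    have := intervalIntegral.norm_integral_le_of_norm_le_const (a := s) (b := t)
      (C := L * (t - s)) (f := fun r => φ r - φ s) (by
        intro x hx
        rw [uIoc_of_le hst] at hx
        refine (lip s x h0s hx.1.le (hx.2.trans htT)).trans ?_
        have := hx.2
        gcongr)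
    rw [abs_of_nonneg hd.le] at this
    rw [e, norm_smul, Real.norm_of_nonneg (by positivity), inv_mul_le_iff₀ hd]
    linarith [mul_comm (L * (t - s)) (t - s)]
  · rw [diff s t h0s hst htT, intervalIntegral.integral_add (jaφ s t h0s hst htT)
      (jbu s t h0s hst htT)]
    have e1 : ∫ r in s..t, A.mulVec (φ r) = A.mulVec (∫ r in s..t, φ r) :=
      a.intervalIntegral_comp_comm (jφ s t h0s hst htT)
    have e2 : ∫ r in s..t, B.mulVec (u r) = B.mulVec (∫ r in s..t, u r) :=
      b.intervalIntegral_comp_comm (ju s t h0s hst htT)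
    rw [e1, e2, Matrix.mulVec_smul, Matrix.mulVec_smul, ← smul_add, smul_smul,
      mul_inv_cancel₀ hd.ne', one_smul]

/-- Points for which an Euler step of length `h` is `c`-close to `S`. -/
def EulerSet (A : Matrix (Fin n) (Fin n) ℝ) (B : Matrix (Fin n) (Fin m) ℝ) (M : ℝ)
    (S : Set (Fin n → ℝ)) (h c : ℝ) : Set (Fin n → ℝ) :=
  {z | ∃ w ∈ S, ∃ u : Fin m → ℝ, ‖u‖ ≤ M ∧ ‖w - z - h • (A.mulVec z + B.mulVec u)‖ ≤ c}

lemma EulerSet.convex (A : Matrix (Fin n) (Fin n) ℝ) (B : Matrix (Fin n) (Fin m) ℝ) (M : ℝ)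
    {S : Set (Fin n → ℝ)} (hS : Convex ℝ S) (h c : ℝ) : Convex ℝ (EulerSet A B M S h c) := by
  rintro z ⟨w, hw, u, hu, hz⟩ z' ⟨w', hw', u', hu', hz'⟩ p q hp hq hpq
  refine ⟨p • w + q • w', hS hw hw' hp hq hpq, p • u + q • u', ?_, ?_⟩
  · have := convex_closedBall (0 : Fin m → ℝ) M (x := u) (by simpa using hu)
      (y := u') (by simpa using hu') hp hq hpq
    simpa using this
  · have := convex_closedBall (0 : Fin n → ℝ) c
      (x := w - z - h • (A.mulVec z + B.mulVec u)) (by simpa using hz)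
      (y := w' - z' - h • (A.mulVec z' + B.mulVec u')) (by simpa using hz') hp hq hpq
    rw [mem_closedBall_zero_iff] at this
    have e : p • w + q • w' - (p • z + q • z') -
        h • (A.mulVec (p • z + q • z') + B.mulVec (p • u + q • u'))
        = p • (w - z - h • (A.mulVec z + B.mulVec u)) +
          q • (w' - z' - h • (A.mulVec z' + B.mulVec u')) := by
      simp only [Matrix.mulVec_add, Matrix.mulVec_smul]
      module
    rw [e]
    exact this

lemma EulerSet.isClosed (A : Matrix (Fin n) (Fin n) ℝ) (B : Matrix (Fin n) (Fin m) ℝ) (M : ℝ)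
    {S : Set (Fin n → ℝ)} (hS : IsCompact S) (h c : ℝ) :
    IsCompact (S ∩ EulerSet A B M S h c) := by
  have hA : Continuous fun z : Fin n → ℝ => A.mulVec z :=
    continuous_const.matrix_mulVec continuous_id
  have hBc : Continuous fun z : Fin m → ℝ => B.mulVec z :=
    continuous_const.matrix_mulVec continuous_id
  have h1 : IsCompact ((S ×ˢ S ×ˢ Metric.closedBall (0 : Fin m → ℝ) M) ∩
      {x : (Fin n → ℝ) × (Fin n → ℝ) × (Fin m → ℝ) |
        ‖x.2.1 - x.1 - h • (A.mulVec x.1 + B.mulVec x.2.2)‖ ≤ c}) := by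
    refine (hS.prod (hS.prod (isCompact_closedBall _ _))).inter_right ?_
    refine isClosed_le ?_ continuous_const
    have k1 : Continuous fun x : (Fin n → ℝ) × (Fin n → ℝ) × (Fin m → ℝ) => A.mulVec x.1 := hA.comp (continuous_fst (X := Fin n → ℝ) (Y := (Fin n → ℝ) × (Fin m → ℝ)))
    have k2 : Continuous fun x : (Fin n → ℝ) × (Fin n → ℝ) × (Fin m → ℝ) => B.mulVec x.2.2 := hBc.comp ((continuous_snd (X := Fin n → ℝ) (Y := Fin m → ℝ)).comp
      (continuous_snd (X := Fin n → ℝ) (Y := (Fin n → ℝ) × (Fin m → ℝ))))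
    fun_prop
  convert h1.image continuous_fst using 1
  ext z
  constructor
  · rintro ⟨hz, w, hw, u, hu, hh⟩
    exact ⟨(z, w, u), ⟨⟨hz, hw, by simpa using hu⟩, hh⟩, rfl⟩
  · rintro ⟨⟨z, w, u⟩, ⟨⟨hz, hw, hu⟩, hh⟩, rfl⟩
    exact ⟨hz, w, hw, u, by simpa using hu, hh⟩

lemma euler_bouligand (A : Matrix (Fin n) (Fin n) ℝ) (B : Matrix (Fin n) (Fin m) ℝ) (M C : ℝ)
    {S : Set (Fin n → ℝ)} {x : Fin n → ℝ} (hx : x ∈ S)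
    (H : ∀ h : ℝ, 0 < h → x ∈ EulerSet A B M S h (C * h ^ 2)) :
    ∃ u : Fin m → ℝ, A.mulVec x + B.mulVec u ∈ bouligand S x := by
  have hpos : ∀ k : ℕ, (0 : ℝ) < 1 / ((k : ℝ) + 1) := fun k => by positivity
  choose w hw u hu hle using fun k : ℕ => H _ (hpos k)
  obtain ⟨v, -, σ, hσ, hlim⟩ := (isCompact_closedBall (0 : Fin m → ℝ) M).tendsto_subseq
    (x := u) (fun k => by simpa using hu k)
  refine ⟨v, ?_⟩
  set d := A.mulVec x + B.mulVec v with hd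
  set f : ℝ → ℝ := fun t : ℝ => Metric.infDist (x + t • d) S / t with hf
  have hBc : Continuous fun z : Fin m → ℝ => B.mulVec z :=
    continuous_const.matrix_mulVec continuous_id
  have ht0 : Tendsto (fun j => 1 / ((σ j : ℝ) + 1)) atTop (𝓝 0) :=
    tendsto_one_div_add_atTop_nhds_zero_nat.comp hσ.tendsto_atTop
  have ht : Tendsto (fun j => 1 / ((σ j : ℝ) + 1)) atTop (𝓝[>] 0) :=
    tendsto_nhdsWithin_iff.2 ⟨ht0, Eventually.of_forall fun j => hpos _⟩
  have hnn : ∀ᶠ t in 𝓝[>] (0:ℝ), 0 ≤ f t := by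
    filter_upwards [self_mem_nhdsWithin] with t ht
    exact div_nonneg Metric.infDist_nonneg (le_of_lt ht)
  have hbd : ∀ᶠ t in 𝓝[>] (0:ℝ), f t ≤ ‖d‖ := by
    filter_upwards [self_mem_nhdsWithin] with t ht
    have ht' : 0 < t := ht
    rw [hf]
    simp only
    rw [div_le_iff₀ ht']
    refine (Metric.infDist_le_dist_of_mem hx).trans ?_
    simp [dist_eq_norm, norm_smul, abs_of_pos ht', mul_comm]
  have hf0 : Tendsto (fun j => f (1 / ((σ j : ℝ) + 1))) atTop (𝓝 0) := by
    have hub : Tendsto (fun j => C * (1 / ((σ j : ℝ) + 1)) + ‖B.mulVec v - B.mulVec (u (σ j))‖)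
        atTop (𝓝 0) := by
      have h1 := ((hBc.tendsto v).comp hlim).const_sub (B.mulVec v) |>.norm
      simpa using (ht0.const_mul C).add h1
    refine squeeze_zero (fun j => ?_) (fun j => ?_) hub
    · exact div_nonneg Metric.infDist_nonneg (hpos _).le
    · have hp := hpos (σ j)
      have h1 := hle (σ j)
      generalize (1 / ((σ j : ℝ) + 1)) = t at *
      simp only [hf]
      rw [div_le_iff₀ hp]
      refine (Metric.infDist_le_dist_of_mem (hw (σ j))).trans ?_
      rw [dist_eq_norm]
      have e : x + t • d - w (σ j) = -(w (σ j) - x - t • (A.mulVec x + B.mulVec (u (σ j))))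
          + t • (B.mulVec v - B.mulVec (u (σ j))) := by
        rw [hd]; module
      rw [e]
      refine (norm_add_le _ _).trans ?_
      rw [norm_neg, norm_smul, Real.norm_of_nonneg hp.le]
      nlinarith
  show Filter.liminf f (𝓝[>] 0) = 0
  have hbu : IsBoundedUnder (· ≤ ·) (𝓝[>] (0:ℝ)) f := ⟨‖d‖, by simpa using hbd⟩
  have hbl : IsBoundedUnder (· ≥ ·) (𝓝[>] (0:ℝ)) f := ⟨0, by simpa using hnn⟩
  apply le_antisymm
  · refine le_of_forall_pos_le_add fun ε hε => ?_
    rw [zero_add]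
    refine Filter.liminf_le_of_frequently_le ?_ hbl
    have : ∀ᶠ j in atTop, f (1 / ((σ j : ℝ) + 1)) ≤ ε :=
      (hf0.eventually (gt_mem_nhds hε)).mono fun j hj => le_of_lt hj
    exact ht.frequently this.frequently
  · exact Filter.le_liminf_of_le hbu.isCoboundedUnder_ge hnn

end aux

/-- For the linear system with `0 ∈ X° ⊂ X'°`, RIBC w.r.t. `X` through `X'`
implies there is an `n`-dimensional compact convex set `X₁` with `X ⊆ X₁ ⊆ X'` whose
invariance conditions are solvable. -/
theorem stmt4 {n m : ℕ} (A : Matrix (Fin n) (Fin n) ℝ) (B : Matrix (Fin n) (Fin m) ℝ)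
    (hB : B.rank = m) (X X' : Set (Fin n → ℝ))
    (hX : IsNPolytope X) (hX' : IsNPolytope X')
    (h0 : (0 : Fin n → ℝ) ∈ interior X) (hXX' : interior X ⊂ interior X')
    (hRIBC : RIBC A B 0 X X') :
    ∃ X₁ : Set (Fin n → ℝ), IsCompact X₁ ∧ Convex ℝ X₁ ∧ (interior X₁).Nonempty ∧
      X ⊆ X₁ ∧ X₁ ⊆ X' ∧
      ∀ x ∈ frontier X₁, ∃ u : Fin m → ℝ, A.mulVec x + B.mulVec u ∈ bouligand X₁ x := by
  obtain ⟨M, hM, hR⟩ := hRIBC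
  obtain ⟨V, hV⟩ := hX.1
  obtain ⟨V', hV'⟩ := hX'.1
  have cX : Convex ℝ X := hV ▸ convex_convexHull ℝ _
  have cX' : Convex ℝ X' := hV' ▸ convex_convexHull ℝ _
  have kX' : IsCompact X' := hV' ▸ V'.finite_toSet.isCompact_convexHull ℝ
  obtain ⟨K, hK⟩ := kX'.isBounded.exists_norm_le
  obtain ⟨CA, hCA, hA⟩ := norm_mulVec_bound _ _ A
  obtain ⟨CB, hCB, hBB⟩ := norm_mulVec_bound _ _ B
  have hK0 : 0 ≤ K := (norm_nonneg _).trans (hK 0 (interior_subset (hXX'.1 h0)))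
  obtain ⟨L, hLdef⟩ : ∃ L, L = CA * K + CB * M := ⟨_, rfl⟩
  have hL0 : 0 ≤ L := by rw [hLdef]; positivity
  have hL : ∀ x y, ‖x‖ ≤ K → ‖y‖ ≤ M → ‖A.mulVec x + B.mulVec y‖ ≤ L := by
    intro x y hx hy
    refine (norm_add_le _ _).trans ?_
    rw [hLdef]
    exact add_le_add ((hA x).trans (by gcongr)) ((hBB y).trans (by gcongr))
  let R : Set (Fin n → ℝ) := {z | ∃ T ≥ (0 : ℝ), ∃ u : ℝ → Fin m → ℝ, ∃ φ : ℝ → Fin n → ℝ,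
      Measurable u ∧ IsSol A B 0 u φ T ∧ φ T ∈ interior X ∧
      (∀ t ∈ Set.Icc (0 : ℝ) T, ‖u t‖ ≤ M) ∧
      (∀ t ∈ Set.Icc (0 : ℝ) T, φ t ∈ interior X') ∧ ∃ t ∈ Set.Icc (0 : ℝ) T, φ t = z}
  -- every point of R reaches X° inside R
  have hreach : ∀ z ∈ R, ∃ b ∈ interior X, ∃ h ≥ 0, SReach A B M L R z h ∧ QStep A B M L z b h := by
    rintro z ⟨T, hT, u, φ, hu, hs, hfin, hM', hin, t, ht, rfl⟩
    have q : ∀ r, t ≤ r → r ≤ T → QStep A B M L (φ t) (φ r) (r - t) := fun r h1 h2 =>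
      hs.qstep hT hu hM' (fun r hr => hK _ (interior_subset (hin r hr))) hL0 hL ht.1 h1 h2
    refine ⟨φ T, hfin, T - t, by linarith [ht.2], ?_, q T ht.2 le_rfl⟩
    intro k hk
    refine ⟨φ (t + k), ⟨T, hT, u, φ, hu, hs, hfin, hM', hin, t + k,
      ⟨by linarith [ht.1, hk.1], by linarith [hk.2]⟩, rfl⟩, ?_⟩
    have := q (t + k) (by linarith [hk.1]) (by linarith [hk.2])
    simpa using this
  have hconn : ∀ x ∈ interior X, ∀ y ∈ interior X, ∃ h ≥ 0, SReach A B M L R x h ∧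
      QStep A B M L x y h ∧ (x ≠ y → 0 < h) := by
    intro x hx y hy
    obtain ⟨T, hT, u, φ, hu, hs, hφ0, hφT, hM', hin⟩ := hR x hx y hy
    have q : ∀ r, 0 ≤ r → r ≤ T → QStep A B M L (φ 0) (φ r) (r - 0) := fun r h1 h2 =>
      hs.qstep hT hu hM' (fun r hr => hK _ (interior_subset (hin r hr))) hL0 hL le_rfl h1 h2
    refine ⟨T, hT, ?_, ?_, ?_⟩
    · intro k hk
      refine ⟨φ k, ⟨T, hT, u, φ, hu, hs, hφT ▸ hy, hM', hin, k, hk, rfl⟩, ?_⟩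
      simpa [hφ0] using q k hk.1 hk.2
    · simpa [hφ0, hφT] using q T hT le_rfl
    · intro hne
      refine lt_of_le_of_ne hT ?_
      rintro rfl
      exact hne (hφ0.symm.trans hφT)
  have hXR : interior X ⊆ R := by
    intro x hx
    obtain ⟨T, hT, u, φ, hu, hs, hφ0, hφT, hM', hin⟩ := hR x hx x hx
    exact ⟨T, hT, u, φ, hu, hs, hφT ▸ hx, hM', hin, 0, ⟨le_rfl, hT⟩, hφ0⟩
  have hRX' : R ⊆ X' := by
    rintro z ⟨T, hT, u, φ, hu, hs, hfin, hM', hin, t, ht, rfl⟩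
    exact interior_subset (hin t ht)
  let X₁ := closure (convexHull ℝ R)
  have hX₁X' : X₁ ⊆ X' := closure_minimal (convexHull_min hRX' cX') kX'.isClosed
  have kX₁ : IsCompact X₁ := kX'.of_isClosed_subset isClosed_closure hX₁X'
  have cX₁ : Convex ℝ X₁ := (convex_convexHull ℝ R).closure
  have hRX₁ : R ⊆ X₁ := (subset_convexHull ℝ R).trans subset_closure
  have hXX₁ : X ⊆ X₁ := by
    have h1 : X ⊆ closure (interior X) := by
      rw [cX.closure_interior_eq_closure_of_nonempty_interior ⟨0, h0⟩]
      exact subset_closure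
    exact h1.trans (closure_minimal (hXR.trans hRX₁) isClosed_closure)
  refine ⟨X₁, kX₁, cX₁, ⟨0, interior_mono hXX₁ h0⟩, hXX₁, hX₁X', ?_⟩
  intro x hxf
  have hx : x ∈ X₁ := isClosed_closure.frontier_subset hxf
  -- n ≥ 1
  obtain ⟨q, hq, hq0⟩ : ∃ q ∈ interior X, (0 : Fin n → ℝ) ≠ q := by
    by_contra hcon
    push Not at hcon
    have hsub : ∀ y : Fin n → ℝ, y = 0 := by
      intro y
      by_contra hy
      have hcts : Tendsto (fun t : ℝ => t • y) (𝓝[>] 0) (𝓝 0) := by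
        have : Continuous fun t : ℝ => t • y := by fun_prop
        have := this.tendsto 0
        rw [zero_smul] at this
        exact this.mono_left nhdsWithin_le_nhds
      have hev := hcts.eventually (isOpen_interior.mem_nhds h0)
      obtain ⟨t, ht1, ht2⟩ := (hev.and self_mem_nhdsWithin).exists
      have h3 := (hcon _ ht1).symm
      rw [smul_eq_zero] at h3
      rcases h3 with h3 | h3
      · exact (ne_of_gt (show (0:ℝ) < t from ht2)) h3
      · exact hy h3
    have hnot := hxf.2
    apply hnot
    rw [hsub x]
    exact interior_mono hXX₁ h0
  obtain ⟨T1, hT1, s1, q1, p1⟩ := hconn 0 h0 q hq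
  obtain ⟨T2, hT2, s2, q2, -⟩ := hconn q hq 0 h0
  have hT1' := p1 hq0
  have hloop : SReach A B M L R 0 (T1 + T2) := s1.trans hT1 q1 s2
  have hloopq : QStep A B M L 0 0 (T1 + T2) := q1.trans hT1 hT2 q2
  have hall : ∀ k : ℕ, SReach A B M L R 0 (k * (T1 + T2)) := by
    intro k
    induction k with
    | zero =>
      intro r hr
      exact hloop r ⟨hr.1, hr.2.trans (by simp; linarith)⟩
    | succ k ih =>
      have := hloop.trans (by linarith) hloopq ih
      convert this using 1
      push_cast; ring
  have hzero : ∀ h, SReach A B M L R 0 h := by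
    intro h
    obtain ⟨k, hk⟩ := exists_nat_ge (h / (T1 + T2))
    rw [div_le_iff₀ (by linarith)] at hk
    exact fun r hr => hall k r ⟨hr.1, hr.2.trans hk⟩
  have hEuler : ∀ h : ℝ, 0 < h → x ∈ EulerSet A B M X₁ h ((CA * L) * h ^ 2) := by
    intro h hh
    have h1 : R ⊆ EulerSet A B M X₁ h ((CA * L) * h ^ 2) := by
      intro z hz
      obtain ⟨b, hb, k, hk, sk, qk⟩ := hreach z hz
      obtain ⟨l, hl, sl, ql, -⟩ := hconn b hb 0 h0
      have hS : SReach A B M L R z (k + l + h) :=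
        (sk.trans hk qk sl).trans (by linarith) (qk.trans hk hl ql) (hzero h)
      obtain ⟨w, hw, ξ, u, b1, b2, b3, b4⟩ := hS h ⟨hh.le, by linarith⟩
      refine ⟨w, hRX₁ hw, u, b1, ?_⟩
      have e : w - z - h • (A.mulVec z + B.mulVec u) = h • A.mulVec (ξ - z) := by
        rw [b4, Matrix.mulVec_sub]; module
      rw [e, norm_smul, Real.norm_of_nonneg hh.le]
      calc h * ‖A.mulVec (ξ - z)‖ ≤ h * (CA * (L * h)) := by
            gcongr; exact (hA _).trans (by gcongr)
        _ = _ := by ring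
    have h2 : convexHull ℝ R ⊆ X₁ ∩ EulerSet A B M X₁ h ((CA * L) * h ^ 2) :=
      subset_inter subset_closure (convexHull_min h1 (EulerSet.convex A B M cX₁ _ _))
    exact (closure_minimal h2 (EulerSet.isClosed A B M kX₁ _ _).isClosed hx).2
  exact euler_bouligand A B M _ hx hEuler
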